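/- Let (W,S) be a Coxeter system with S finite, with geometric realization σ : W → GL(E) and root system Φ = Φ⁺ ⊔ Φ⁻. Let s ∈ S and x, y ∈ W with ℓ(xs) > ℓ(x) and ℓ(sy) > ℓ(y). Set A₁ := Φ_y \ y⁻¹.Φ_x⁻ and B₁ := Φ_y \ (y⁻¹s).Φ_x⁻. Then for every β ∈ A₁ \ B₁ one has (y⁻¹sy).β ∈ B₁ \ A₁; in particular β ↦ (y⁻¹sy).β defines an injection of A₁ \ B₁ into B₁ \ A₁, so card(A₁ \ B₁) ≤ card(B₁ \ A₁). -/

import Mathlib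

/-- The symmetric bilinear form on `E = B → ℝ` attached to a Coxeter matrix `M`:
`(e_i, e_j) = -cos (π / m_{ij})`, interpreted as `-1` when `m_{ij} = 0` (infinite order). -/
noncomputable def geomForm {B : Type*} [Fintype B] (M : CoxeterMatrix B)
    (f g : B → ℝ) : ℝ :=
  ∑ i, ∑ j, f i * g j *
    (if M i j = 0 then (-1 : ℝ) else -Real.cos (Real.pi / (M i j)))

/-- The set of roots `Φ = {x.e_s : x ∈ W, s ∈ S}` of the geometric realization `σ`. -/
def rootSet {B W : Type*} [DecidableEq B] [Group W]
    (σ : W →* ((B → ℝ) ≃ₗ[ℝ] (B → ℝ))) : Set (B → ℝ) :=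
  {v | ∃ (w : W) (i : B), σ w (Pi.single i 1) = v}

/-- The set of positive roots `Φ⁺`: roots which are nonnegative linear combinations
of the basis vectors `e_s`. -/
def posRoots {B W : Type*} [DecidableEq B] [Group W]
    (σ : W →* ((B → ℝ) ≃ₗ[ℝ] (B → ℝ))) : Set (B → ℝ) :=
  {v ∈ rootSet σ | ∀ i, 0 ≤ v i}

/-- The set of negative roots `Φ⁻ = -Φ⁺`. -/
def negRoots {B W : Type*} [DecidableEq B] [Group W]
    (σ : W →* ((B → ℝ) ≃ₗ[ℝ] (B → ℝ))) : Set (B → ℝ) :=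
  {v | -v ∈ posRoots σ}

/-- The inversion set `Φ_x = {α ∈ Φ⁺ : x.α ∈ Φ⁻}`. -/
def invSet {B W : Type*} [DecidableEq B] [Group W]
    (σ : W →* ((B → ℝ) ≃ₗ[ℝ] (B → ℝ))) (x : W) : Set (B → ℝ) :=
  {α ∈ posRoots σ | σ x α ∈ negRoots σ}

/-- The set `Φ_x⁻ = -Φ_x`. -/
def minusInvSet {B W : Type*} [DecidableEq B] [Group W]
    (σ : W →* ((B → ℝ) ≃ₗ[ℝ] (B → ℝ))) (x : W) : Set (B → ℝ) :=
  {v | -v ∈ invSet σ x}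

section GeometricRealization

variable {B W : Type*} [Group W]

lemma mem_image_iff_apply_inv_mem (σ : W →* ((B → ℝ) ≃ₗ[ℝ] (B → ℝ))) (w : W)
    (T : Set (B → ℝ)) (v : B → ℝ) : v ∈ σ w '' T ↔ σ w⁻¹ v ∈ T := by
  constructor
  · rintro ⟨u, hu, rfl⟩
    rwa [← LinearEquiv.mul_apply, ← map_mul, inv_mul_cancel, map_one]
  · intro h
    refine ⟨_, h, ?_⟩
    rw [← LinearEquiv.mul_apply, ← map_mul, mul_inv_cancel, map_one]
    rfl

variable [DecidableEq B]

lemma apply_mem_rootSet (σ : W →* ((B → ℝ) ≃ₗ[ℝ] (B → ℝ))) (w : W) {v : B → ℝ}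
    (hv : v ∈ rootSet σ) : σ w v ∈ rootSet σ := by
  obtain ⟨u, i, rfl⟩ := hv
  exact ⟨w * u, i, by rw [map_mul, LinearEquiv.mul_apply]⟩

lemma ne_zero_of_mem_rootSet {σ : W →* ((B → ℝ) ≃ₗ[ℝ] (B → ℝ))} {v : B → ℝ}
    (hv : v ∈ rootSet σ) : v ≠ 0 := by
  obtain ⟨u, i, rfl⟩ := hv
  simp

variable [Fintype B] {M : CoxeterMatrix B}

/-- The form `geomForm` on basis vectors. -/
lemma geomForm_single_single (M : CoxeterMatrix B) (i j : B) :
    geomForm M (Pi.single i 1) (Pi.single j 1) =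
      if M i j = 0 then (-1 : ℝ) else -Real.cos (Real.pi / (M i j)) := by
  unfold geomForm
  rw [Finset.sum_eq_single i (by simp +contextual) (by simp),
    Finset.sum_eq_single j (by simp +contextual) (by simp)]
  simp

/-- The coefficients of the roots of a rank two Coxeter group of order `2 * m`
(`m = 0` standing for infinite order). -/
noncomputable def dihedralCoeff (m k : ℕ) : ℝ :=
  if m = 0 then k else Real.sin (k * (Real.pi / m)) / Real.sin (Real.pi / m)

lemma sin_pi_div_pos {m : ℕ} (hm : 2 ≤ m) : 0 < Real.sin (Real.pi / m) := by
  have h2 : (2 : ℝ) ≤ m := by exact_mod_cast hm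
  apply Real.sin_pos_of_pos_of_lt_pi
  · positivity
  · exact div_lt_self Real.pi_pos (by linarith)

lemma dihedralCoeff_zero (m : ℕ) : dihedralCoeff m 0 = 0 := by
  simp [dihedralCoeff]

lemma dihedralCoeff_one {m : ℕ} (hm : m ≠ 1) : dihedralCoeff m 1 = 1 := by
  unfold dihedralCoeff
  split_ifs with h
  · simp
  · have := sin_pi_div_pos (m := m) (by omega)
    simp [this.ne']

lemma dihedralCoeff_add_two (m k : ℕ) :
    dihedralCoeff m (k + 2) =
      -2 * (if m = 0 then (-1 : ℝ) else -Real.cos (Real.pi / m)) * dihedralCoeff m (k + 1)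
        - dihedralCoeff m k := by
  unfold dihedralCoeff
  split_ifs with h
  · push_cast
    ring
  · set θ := Real.pi / m
    have h1 : ((k + 2 : ℕ) : ℝ) * θ = ((k + 1 : ℕ) : ℝ) * θ + θ := by push_cast; ring
    have h2 : (k : ℝ) * θ = ((k + 1 : ℕ) : ℝ) * θ - θ := by push_cast; ring
    rw [h1, h2, Real.sin_add, Real.sin_sub]
    ring

lemma dihedralCoeff_nonneg {m k : ℕ} (hm : m ≠ 1) (hk : m ≠ 0 → k ≤ m) :
    0 ≤ dihedralCoeff m k := by
  unfold dihedralCoeff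
  split_ifs with h
  · positivity
  · have hpos := sin_pi_div_pos (m := m) (by omega)
    have hm0 : (0 : ℝ) < m := by exact_mod_cast Nat.pos_of_ne_zero h
    have hkm : (k : ℝ) ≤ m := by exact_mod_cast hk h
    refine div_nonneg (Real.sin_nonneg_of_nonneg_of_le_pi (by positivity) ?_) hpos.le
    calc (k : ℝ) * (Real.pi / m) ≤ m * (Real.pi / m) := by gcongr
      _ = Real.pi := by field_simp

/-- `σ` is the geometric realization of the Coxeter system `cs`. -/
def IsGeomRealization (cs : CoxeterSystem M W) (σ : W →* ((B → ℝ) ≃ₗ[ℝ] (B → ℝ))) : Prop :=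
  ∀ (i : B) (e : B → ℝ),
    σ (cs.simple i) e = e - (2 * geomForm M e (Pi.single i 1)) • (Pi.single i 1 : B → ℝ)

namespace IsGeomRealization

variable {cs : CoxeterSystem M W} {σ : W →* ((B → ℝ) ≃ₗ[ℝ] (B → ℝ))}

lemma simple_single_self (hσ : IsGeomRealization cs σ) (i : B) :
    σ (cs.simple i) (Pi.single i 1) = -Pi.single i 1 := by
  rw [hσ, geomForm_single_single]
  simp
  module

/-- The action of an alternating word `⋯ j i j` on the basis vector `e_i`. -/
lemma alternatingWord_single (hσ : IsGeomRealization cs σ) {i j : B} (hij : i ≠ j) (k : ℕ) :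
    σ (cs.wordProd (CoxeterSystem.alternatingWord i j k)) (Pi.single i 1) =
      dihedralCoeff (M i j) (k + 1) • Pi.single (if Even k then i else j) 1 +
        dihedralCoeff (M i j) k • Pi.single (if Even k then j else i) 1 := by
  induction k with
  | zero =>
    simp [CoxeterSystem.alternatingWord, dihedralCoeff_zero,
      dihedralCoeff_one (M.off_diagonal i j hij)]
  | succ k ih =>
    rw [CoxeterSystem.alternatingWord_succ', cs.wordProd_cons, map_mul, LinearEquiv.mul_apply, ih,
      dihedralCoeff_add_two]
    by_cases hk : Even k
    · have hk' : ¬ Even (k + 1) := by simpa [Nat.even_add_one] using hk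
      simp only [hk, hk', if_true, if_false, map_add, map_smul, hσ.simple_single_self]
      rw [hσ, geomForm_single_single]
      module
    · have hk' : Even (k + 1) := by simpa [Nat.even_add_one] using hk
      simp only [hk, hk', if_true, if_false, map_add, map_smul, hσ.simple_single_self]
      rw [hσ, geomForm_single_single, M.symmetric j i]
      module

/-- If `ℓ (w s) > ℓ w` then `w.e_s` is nonnegative. -/
theorem apply_single_nonneg (hσ : IsGeomRealization cs σ) (w : W) (i : B)
    (h : cs.length w < cs.length (w * cs.simple i)) : 0 ≤ σ w (Pi.single i 1) := by
  induction hn : cs.length w using Nat.strong_induction_on generalizing w i with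
  | _ n ih =>
  subst hn
  by_cases hw : w = 1
  · subst hw
    simp [Pi.single_nonneg]
  obtain ⟨j, hj⟩ := cs.exists_rightDescent_of_ne_one hw
  have hij : i ≠ j := by
    rintro rfl
    exact absurd hj (by unfold CoxeterSystem.IsRightDescent; omega)
  let p : ℕ → W := fun k => cs.wordProd (CoxeterSystem.alternatingWord i j k)
  let a : ℕ → B := fun k => if Even k then j else i
  have p_succ (k : ℕ) : p (k + 1) = cs.simple (a k) * p k := by
    simp only [p, a, CoxeterSystem.alternatingWord_succ', cs.wordProd_cons]
  have length_p_le (k : ℕ) : cs.length (p k) ≤ k := by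
    simpa using cs.length_wordProd_le (CoxeterSystem.alternatingWord i j k)
  let P : ℕ → Prop := fun k => cs.length (w * (p k)⁻¹) + k = cs.length w
  classical
  have hP1 : P 1 := by
    have := cs.isRightDescent_iff.mp hj
    simpa [P, p, CoxeterSystem.alternatingWord] using this
  have hlen : 1 ≤ cs.length w := by
    have : cs.length (w * (p 1)⁻¹) + 1 = cs.length w := hP1
    omega
  obtain ⟨k, hk1, hPk, hmax⟩ : ∃ k, 1 ≤ k ∧ P k ∧ ¬ P (k + 1) := by
    refine ⟨Nat.findGreatest P (cs.length w), Nat.le_findGreatest hlen hP1,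
      Nat.findGreatest_spec hlen hP1, fun hP => ?_⟩
    have h1 : Nat.findGreatest P (cs.length w) + 1 ≤ cs.length w := by
      have : _ + (_ + 1) = cs.length w := hP
      omega
    have := Nat.le_findGreatest h1 hP
    omega
  set v := w * (p k)⁻¹ with hv
  have hvw : w = v * p k := by simp [hv]
  have hvk : cs.length v + k = cs.length w := hPk
  have hasc_new : cs.length v < cs.length (v * cs.simple (a k)) := by
    by_contra hcon
    apply hmax
    have h1 : w * (p (k + 1))⁻¹ = v * cs.simple (a k) := by
      simp [p_succ, hv, mul_assoc]
    have := cs.length_mul_simple v (a k)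
    change cs.length (w * (p (k + 1))⁻¹) + (k + 1) = _
    rw [h1]
    omega
  have hasc_old : cs.length v < cs.length (v * cs.simple (a (k - 1))) := by
    have h1 : w = (v * cs.simple (a (k - 1))) * p (k - 1) := by
      rw [mul_assoc, ← p_succ, Nat.sub_add_cancel hk1, ← hvw]
    have h2 := cs.length_mul_le (v * cs.simple (a (k - 1))) (p (k - 1))
    rw [← h1] at h2
    have := length_p_le (k - 1)
    omega
  have hkm : M i j ≠ 0 → k + 1 ≤ M i j := by
    intro hm
    by_contra hcon
    have hred := cs.not_isReduced_alternatingWord j i (m := k + 1)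
      (by rwa [M.symmetric]) (by rw [M.symmetric]; omega)
    have h1 : w * cs.simple i = v * cs.wordProd (CoxeterSystem.alternatingWord j i (k + 1)) := by
      rw [CoxeterSystem.alternatingWord_succ, cs.wordProd_concat, ← mul_assoc, ← hvw]
    have h2 := cs.length_mul_le v (cs.wordProd (CoxeterSystem.alternatingWord j i (k + 1)))
    have h3 := cs.length_wordProd_le (CoxeterSystem.alternatingWord j i (k + 1))
    have h4 : cs.length (cs.wordProd (CoxeterSystem.alternatingWord j i (k + 1))) ≠ k + 1 := by
      simpa [CoxeterSystem.IsReduced] using hred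
    rw [← h1] at h2
    rw [CoxeterSystem.length_alternatingWord] at h3
    omega
  have hlt : cs.length v < cs.length w := by omega
  have hm1 := M.off_diagonal i j hij
  have e1 : a (k - 1) = if Even k then i else j := by
    obtain ⟨l, rfl⟩ := Nat.exists_eq_add_of_le' hk1
    by_cases hl : Even l <;> simp [a, hl, Nat.even_add_one]
  have hw_eq : σ w (Pi.single i 1) =
      dihedralCoeff (M i j) (k + 1) • σ v (Pi.single (a (k - 1)) 1) +
        dihedralCoeff (M i j) k • σ v (Pi.single (a k) 1) := by
    rw [hvw, map_mul, LinearEquiv.mul_apply, hσ.alternatingWord_single hij k, map_add, map_smul,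
      map_smul, e1]
  rw [hw_eq]
  exact add_nonneg
    (smul_nonneg (dihedralCoeff_nonneg hm1 hkm) (ih _ hlt v _ hasc_old rfl))
    (smul_nonneg (dihedralCoeff_nonneg hm1 fun h => (Nat.le_succ k).trans (hkm h))
      (ih _ hlt v _ hasc_new rfl))

lemma neg_mem_rootSet (hσ : IsGeomRealization cs σ) {v : B → ℝ} (hv : v ∈ rootSet σ) :
    -v ∈ rootSet σ := by
  obtain ⟨w, i, rfl⟩ := hv
  exact ⟨w * cs.simple i, i, by
    rw [map_mul, LinearEquiv.mul_apply, hσ.simple_single_self, map_neg]⟩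

/-- Every root is positive or negative. -/
theorem mem_posRoots_or_mem_negRoots (hσ : IsGeomRealization cs σ) {v : B → ℝ}
    (hv : v ∈ rootSet σ) : v ∈ posRoots σ ∨ v ∈ negRoots σ := by
  have hneg := hσ.neg_mem_rootSet hv
  obtain ⟨w, i, rfl⟩ := id hv
  rcases cs.length_mul_simple w i with h | h
  · exact Or.inl ⟨hv, hσ.apply_single_nonneg w i (by omega)⟩
  · refine Or.inr ⟨hneg, ?_⟩
    have := hσ.apply_single_nonneg (w * cs.simple i) i (by
      rw [cs.simple_mul_simple_cancel_right]; omega)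
    rwa [map_mul, LinearEquiv.mul_apply, hσ.simple_single_self, map_neg] at this

end IsGeomRealization

end GeometricRealization

/-- Let `s ∈ S` and `x, y ∈ W` with `ℓ(xs) > ℓ(x)` and
`ℓ(sy) > ℓ(y)`.  Set `A₁ := Φ_y \ y⁻¹.Φ_x⁻` and `B₁ := Φ_y \ (y⁻¹s).Φ_x⁻`.
Then `β ↦ (y⁻¹sy).β` maps `A₁ \ B₁` into `B₁ \ A₁` injectively, so
`card (A₁ \ B₁) ≤ card (B₁ \ A₁)`. -/
theorem card_diff_le_card_diff_one
    {B W : Type*} [Fintype B] [DecidableEq B] [Group W]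
    {M : CoxeterMatrix B} (cs : CoxeterSystem M W)
    (σ : W →* ((B → ℝ) ≃ₗ[ℝ] (B → ℝ)))
    (hσ : ∀ (i : B) (e : B → ℝ),
      σ (cs.simple i) e = e - (2 * geomForm M e (Pi.single i 1)) • (Pi.single i 1 : B → ℝ))
    (i : B) (x y : W)
    (hx : cs.length (x * cs.simple i) > cs.length x)
    (hy : cs.length (cs.simple i * y) > cs.length y)
    (A₁ B₁ : Set (B → ℝ))
    (hA₁ : A₁ = invSet σ y \ (σ y⁻¹) '' minusInvSet σ x)
    (hB₁ : B₁ = invSet σ y \ (σ (y⁻¹ * cs.simple i)) '' minusInvSet σ x) :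
    (∀ β ∈ A₁ \ B₁, σ (y⁻¹ * cs.simple i * y) β ∈ B₁ \ A₁) ∧
    Set.InjOn (σ (y⁻¹ * cs.simple i * y)) (A₁ \ B₁) ∧
    Cardinal.mk ↥(A₁ \ B₁) ≤ Cardinal.mk ↥(B₁ \ A₁) := by
  have hgeom : IsGeomRealization cs σ := hσ
  have mul_app (u v : W) (e : B → ℝ) : σ (u * v) e = σ u (σ v e) := by
    rw [map_mul, LinearEquiv.mul_apply]
  have maps : ∀ β ∈ A₁ \ B₁, σ (y⁻¹ * cs.simple i * y) β ∈ B₁ \ A₁ := by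
    subst hA₁ hB₁
    rintro β ⟨⟨⟨⟨hβroot, hβnonneg⟩, hγneg⟩, hγx⟩, hβB⟩
    have hδ : β ∈ σ (y⁻¹ * cs.simple i) '' minusInvSet σ x := by
      by_contra hcon
      exact hβB ⟨⟨⟨hβroot, hβnonneg⟩, hγneg⟩, hcon⟩
    rw [mem_image_iff_apply_inv_mem, inv_inv] at hγx
    rw [mem_image_iff_apply_inv_mem, mul_inv_rev, inv_inv, cs.inv_simple, mul_app] at hδ
    set γ := σ y β with hγ
    have hss (e : B → ℝ) : σ (cs.simple i) (σ (cs.simple i) e) = e := by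
      rw [← mul_app, cs.simple_mul_simple_self, map_one]; rfl
    have hyy (e : B → ℝ) : σ y (σ y⁻¹ e) = e := by
      rw [← mul_app, mul_inv_cancel, map_one]; rfl
    have hβγ : σ y⁻¹ γ = β := by
      rw [hγ, ← mul_app, inv_mul_cancel, map_one]; rfl
    have himg : σ (y⁻¹ * cs.simple i * y) β = σ y⁻¹ (σ (cs.simple i) γ) := by
      rw [mul_app, mul_app]
    -- `x.(-γ)` is a positive root, since `-γ` is positive and not in `Φ_x`
    have hxγ : 0 ≤ σ x (-γ) := by
      rcases hgeom.mem_posRoots_or_mem_negRoots (apply_mem_rootSet σ x hγneg.1) with h | h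
      · exact h.2
      · exact absurd ⟨hγneg, h⟩ hγx
    have hxs := hgeom.apply_single_nonneg x i hx
    have hys : 0 ≤ σ y⁻¹ (Pi.single i 1) := by
      apply hgeom.apply_single_nonneg
      rwa [← cs.length_inv (y⁻¹ * _), mul_inv_rev, cs.inv_simple, inv_inv, cs.length_inv]
    have hform : geomForm M γ (Pi.single i 1) < 0 := by
      by_contra! hcon
      have h1 : 0 ≤ -σ x (-σ (cs.simple i) γ) := hδ.2.2
      have h2 : σ x (-σ (cs.simple i) γ) =
          σ x (-γ) + (2 * geomForm M γ (Pi.single i 1)) • σ x (Pi.single i 1) := by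
        rw [hσ, ← map_smul, ← map_add]
        congr 1
        abel
      have h3 : 0 ≤ σ x (-σ (cs.simple i) γ) := by
        rw [h2]
        exact add_nonneg hxγ (smul_nonneg (by linarith) hxs)
      exact ne_zero_of_mem_rootSet (apply_mem_rootSet σ x hδ.1.1)
        (le_antisymm (neg_nonneg.mp h1) h3)
    have hpos : 0 ≤ σ y⁻¹ (σ (cs.simple i) γ) := by
      rw [hσ, map_sub, map_smul, hβγ, sub_eq_add_neg, ← neg_smul]
      exact add_nonneg hβnonneg (smul_nonneg (by linarith) hys)
    rw [himg]
    refine ⟨⟨⟨⟨?_, hpos⟩, ?_⟩, ?_⟩, fun hA => hA.2 ?_⟩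
    · rw [← himg]
      exact apply_mem_rootSet σ _ hβroot
    · rw [hyy]
      exact hδ.1
    · rw [mem_image_iff_apply_inv_mem, mul_inv_rev, inv_inv, cs.inv_simple, mul_app, hyy, hss]
      exact hγx
    · rw [mem_image_iff_apply_inv_mem, inv_inv, hyy]
      exact hδ
  have inj : Set.InjOn (σ (y⁻¹ * cs.simple i * y)) (A₁ \ B₁) := (LinearEquiv.injective _).injOn
  exact ⟨maps, inj, Cardinal.mk_le_of_injective (f := Set.MapsTo.restrict _ _ _ maps)
    ((Set.MapsTo.restrict_inj maps).mpr inj)⟩
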